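/- arXiv:2403.03464 — 2 statements merged into one kernel-verified Lean document; each statement's English description precedes it below -/
import Mathlib

section
/- G(q)G(q⁴) - q H(q)H(q⁴) = (q^{10};q^{10})_∞⁵ / ((q²;q²)_∞ (q⁵;q⁵)_∞² (q^{20};q^{20})_∞²), where G(q) = 1/(q,q⁴;q⁵)_∞ and H(q) = 1/(q²,q³;q⁵)_∞. -/
open scoped BigOperators

/-- Infinite q-Pochhammer symbol $(a;q)_\infty$. -/
noncomputable def qPochInf (q a : ℂ) : ℂ := ∏' j : ℕ, (1 - a * q ^ j)

/-- Rogers–Ramanujan function $G(q) = 1/(q,q^4;q^5)_\infty$. -/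
noncomputable def RRG (q : ℂ) : ℂ := (qPochInf (q ^ 5) q * qPochInf (q ^ 5) (q ^ 4))⁻¹

/-- Rogers–Ramanujan function $H(q) = 1/(q^2,q^3;q^5)_\infty$. -/
noncomputable def RRH (q : ℂ) : ℂ := (qPochInf (q ^ 5) (q ^ 2) * qPochInf (q ^ 5) (q ^ 3))⁻¹

open Filter Topology

theorem summable_neg_mul_pow {q : ℂ} (hq : ‖q‖ < 1) (a : ℂ) :
    Summable fun j : ℕ => -(a * q ^ j) :=
  ((summable_geometric_of_norm_lt_one hq).mul_left a).neg

theorem multipliable_one_sub_mul_pow {q : ℂ} (hq : ‖q‖ < 1) (a : ℂ) :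
    Multipliable fun j : ℕ => 1 - a * q ^ j := by
  simpa only [sub_eq_add_neg] using
    Complex.multipliable_one_add_of_summable (summable_neg_mul_pow hq a)

theorem tendsto_prod_qPochInf {q : ℂ} (hq : ‖q‖ < 1) (a : ℂ) :
    Tendsto (fun n : ℕ => ∏ j ∈ Finset.range n, (1 - a * q ^ j)) atTop (𝓝 (qPochInf q a)) :=
  (multipliable_one_sub_mul_pow hq a).hasProd.tendsto_prod_nat

theorem one_sub_mul_pow_ne_zero {q a : ℂ} (hq : ‖q‖ < 1) (ha : ‖a‖ < 1) (j : ℕ) :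
    1 - a * q ^ j ≠ 0 := by
  intro h
  have h1 : ‖a * q ^ j‖ = 1 := by rw [← sub_eq_zero.mp h, norm_one]
  rw [norm_mul, norm_pow] at h1
  have h2 : ‖q‖ ^ j ≤ 1 := pow_le_one₀ (norm_nonneg q) hq.le
  nlinarith [norm_nonneg a, norm_nonneg q]

theorem qPochInf_ne_zero {q a : ℂ} (hq : ‖q‖ < 1) (ha : ‖a‖ < 1) : qPochInf q a ≠ 0 := by
  have h := tprod_one_add_ne_zero_of_summable (f := fun j : ℕ => -(a * q ^ j))
    (fun j => by simpa only [← sub_eq_add_neg] using one_sub_mul_pow_ne_zero hq ha j)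
    (summable_neg_mul_pow hq a).norm
  simpa only [qPochInf, ← sub_eq_add_neg] using h

theorem qPochInf_eq_one_sub_mul {q : ℂ} (hq : ‖q‖ < 1) (a : ℂ) :
    qPochInf q a = (1 - a) * qPochInf q (a * q) := by
  have h : (fun j : ℕ => 1 - a * q ^ (j + 1)) = fun j => 1 - a * q * q ^ j := by
    funext j; ring
  have h2 := tprod_eq_zero_mul' (f := fun j : ℕ => 1 - a * q ^ j)
    (by simpa only [h] using multipliable_one_sub_mul_pow hq (a * q))
  simpa only [qPochInf, h, pow_zero, mul_one] using h2

theorem norm_pow_lt_one {q : ℂ} (hq : ‖q‖ < 1) {n : ℕ} (hn : n ≠ 0) : ‖q ^ n‖ < 1 := by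
  rw [norm_pow]; exact pow_lt_one₀ (norm_nonneg q) hq hn

theorem qPochInf_eq_prod_residues {q : ℂ} (hq : ‖q‖ < 1) (a : ℂ) {m : ℕ} (hm : m ≠ 0) :
    qPochInf q a = ∏ i ∈ Finset.range m, qPochInf (q ^ m) (a * q ^ i) := by
  have hfin (n : ℕ) : ∏ j ∈ Finset.range (n * m), (1 - a * q ^ j) =
      ∏ i ∈ Finset.range m, ∏ j ∈ Finset.range n, (1 - a * q ^ i * (q ^ m) ^ j) := by
    induction n with
    | zero => simp
    | succ n ih =>
      rw [Nat.succ_mul, Finset.prod_range_add, ih, ← Finset.prod_mul_distrib]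
      refine Finset.prod_congr rfl fun i _ => ?_
      rw [Finset.prod_range_succ, pow_add, ← pow_mul, mul_comm m n]
      ring
  have h := (tendsto_prod_qPochInf hq a).comp (tendsto_id.atTop_mul_const' (Nat.pos_of_ne_zero hm))
  refine tendsto_nhds_unique (h.congr hfin) (tendsto_finsetProd _ fun i _ => ?_)
  exact tendsto_prod_qPochInf (norm_pow_lt_one hq hm) _

theorem qPochInf_mul_neg {q : ℂ} (hq : ‖q‖ < 1) (a : ℂ) :
    qPochInf q a * qPochInf q (-a) = qPochInf (q ^ 2) (a ^ 2) := by
  have h := (multipliable_one_sub_mul_pow hq a).tprod_mul (multipliable_one_sub_mul_pow hq (-a))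
  have hf : (fun j : ℕ => (1 - a * q ^ j) * (1 - -a * q ^ j)) =
      fun j => 1 - a ^ 2 * (q ^ 2) ^ j := by
    funext j; rw [← pow_mul, mul_comm 2 j, pow_mul]; ring
  rw [hf] at h
  exact h.symm

/-- The general term of the theta series `∑ (-1)^k q^(k(k-1)/2) z^k`. -/
noncomputable def thetaTerm (q z : ℂ) (k : ℤ) : ℂ := q ^ (k * (k - 1) / 2) * (-z) ^ k

/-- The theta series `∑ (-1)^k q^(k(k-1)/2) z^k` over the integers. -/
noncomputable def thetaSeries (q z : ℂ) : ℂ := ∑' k : ℤ, thetaTerm q z k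

theorem thetaTerm_add_one {q z : ℂ} (hq0 : q ≠ 0) (hz : z ≠ 0) (k : ℤ) :
    thetaTerm q z (k + 1) = -(q ^ k * z) * thetaTerm q z k := by
  have h : (k + 1) * (k + 1 - 1) / 2 = k * (k - 1) / 2 + k := by
    rw [← Int.add_mul_ediv_right _ _ two_ne_zero]; congr 1; ring
  rw [thetaTerm, thetaTerm, h, zpow_add₀ hq0, zpow_add_one₀ (neg_ne_zero.mpr hz)]
  ring

theorem thetaTerm_ne_zero {q z : ℂ} (hq0 : q ≠ 0) (hz : z ≠ 0) (k : ℤ) : thetaTerm q z k ≠ 0 :=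
  mul_ne_zero (zpow_ne_zero _ hq0) (zpow_ne_zero _ (neg_ne_zero.mpr hz))

theorem summable_of_ratio_eq_const_mul_pow {q c : ℂ} (hq : ‖q‖ < 1) {f : ℕ → ℂ}
    (hf : ∀ n, f n ≠ 0) (h : ∀ n, f (n + 1) = c * q ^ n * f n) : Summable f := by
  refine summable_of_ratio_test_tendsto_lt_one zero_lt_one (.of_forall hf) ?_
  have h2 : (fun n => ‖f (n + 1)‖ / ‖f n‖) = fun n => ‖c‖ * ‖q‖ ^ n := by
    funext n
    rw [h, norm_mul, norm_mul, norm_pow, mul_div_cancel_right₀ _ (norm_ne_zero_iff.mpr (hf n))]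
  rw [h2]
  simpa using (tendsto_pow_atTop_nhds_zero_of_lt_one (norm_nonneg q) hq).const_mul ‖c‖

theorem summable_thetaTerm {q z : ℂ} (hq : ‖q‖ < 1) (hq0 : q ≠ 0) (hz : z ≠ 0) :
    Summable (thetaTerm q z) := by
  refine Summable.of_nat_of_neg ?_ ?_
  · refine summable_of_ratio_eq_const_mul_pow (c := -z) hq
      (fun n => thetaTerm_ne_zero hq0 hz _) fun n => ?_
    rw [Nat.cast_succ, thetaTerm_add_one hq0 hz, zpow_natCast]
    ring
  · refine summable_of_ratio_eq_const_mul_pow (c := -(q / z)) hq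
      (fun n => thetaTerm_ne_zero hq0 hz _) fun n => ?_
    have h := thetaTerm_add_one hq0 hz (-((n + 1 : ℕ) : ℤ))
    rw [show -((n + 1 : ℕ) : ℤ) + 1 = -(n : ℤ) by push_cast; ring] at h
    rw [h, zpow_neg, zpow_natCast]
    have := pow_ne_zero (n + 1) hq0
    field_simp
    ring

/-- `1 / (q; q)_m` for an integer `m`, which vanishes for negative `m`. -/
noncomputable def invQFactorial (q : ℂ) (m : ℤ) : ℂ :=
  if 0 ≤ m then (∏ j ∈ Finset.range m.toNat, (1 - q * q ^ j))⁻¹ else 0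

theorem invQFactorial_natCast (q : ℂ) (n : ℕ) :
    invQFactorial q n = (∏ j ∈ Finset.range n, (1 - q * q ^ j))⁻¹ := by
  simp [invQFactorial]

theorem invQFactorial_sub_one {q : ℂ} (hq : ‖q‖ < 1) (m : ℤ) :
    invQFactorial q (m - 1) = (1 - q ^ m) * invQFactorial q m := by
  rcases lt_trichotomy m 0 with h | rfl | h
  · rw [invQFactorial, invQFactorial, if_neg (by lia), if_neg (by lia), mul_zero]
  · simp [invQFactorial]
  · obtain ⟨n, rfl⟩ : ∃ n : ℕ, m = n + 1 := ⟨(m - 1).toNat, by lia⟩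
    rw [add_sub_cancel_right, ← Nat.cast_succ, invQFactorial_natCast, invQFactorial_natCast,
      Finset.prod_range_succ, zpow_natCast, pow_succ']
    have h1 := one_sub_mul_pow_ne_zero hq hq n
    rw [mul_inv, mul_left_comm, mul_inv_cancel₀ h1, mul_one]

theorem tendsto_invQFactorial {q : ℂ} (hq : ‖q‖ < 1) :
    Tendsto (invQFactorial q) atTop (𝓝 (qPochInf q q)⁻¹) := by
  have hN : Tendsto Int.toNat atTop atTop :=
    tendsto_atTop_atTop.mpr fun b => ⟨b, fun a ha => by lia⟩
  refine (((tendsto_prod_qPochInf hq q).inv₀ (qPochInf_ne_zero hq hq)).comp hN).congr' ?_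
  filter_upwards [eventually_ge_atTop 0] with m hm
  simp [invQFactorial, hm]

theorem hasSum_finite_triple_product {q z : ℂ} (hq : ‖q‖ < 1) (hq0 : q ≠ 0) (hz : z ≠ 0) (n : ℕ) :
    HasSum (fun k : ℤ => thetaTerm q z k * ((∏ j ∈ Finset.range (2 * n), (1 - q * q ^ j)) *
        (invQFactorial q (n + k) * invQFactorial q (n - k))))
      ((∏ j ∈ Finset.range n, (1 - z * q ^ j)) * ∏ j ∈ Finset.range n, (1 - q / z * q ^ j)) := by
  induction n with
  | zero =>
    convert hasSum_single (0 : ℤ) ?_ using 1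
    · simp [thetaTerm, invQFactorial]
    · intro k hk
      rcases lt_or_gt_of_ne hk with h | h
      · rw [invQFactorial, if_neg (by simpa using h)]; simp
      · rw [mul_comm (invQFactorial q _), invQFactorial, if_neg (by simpa using h)]; simp
  | succ n ih =>
    have h0 := ih.mul_left (1 + q ^ (2 * n + 1))
    have h1 := ((Equiv.subRight (1 : ℤ)).hasSum_iff.mpr ih).mul_left (-(z * q ^ n))
    have h2 := ((Equiv.addRight (1 : ℤ)).hasSum_iff.mpr ih).mul_left (-(q / z * q ^ n))
    convert! (h0.add h1).add h2 using 1
    · funext k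
      simp only [Function.comp_apply, Equiv.subRight_apply, Equiv.coe_addRight]
      have hk := thetaTerm_add_one hq0 hz (k - 1)
      rw [sub_add_cancel] at hk
      have hk1 := thetaTerm_add_one hq0 hz k
      have a1 := invQFactorial_sub_one hq (n + 1 + k)
      have a2 := invQFactorial_sub_one hq (n + k)
      have b1 := invQFactorial_sub_one hq (n + 1 - k)
      have b2 := invQFactorial_sub_one hq (n - k)
      rw [show (n : ℤ) + 1 + k - 1 = n + k by ring] at a1
      rw [show (n : ℤ) + 1 - k - 1 = n - k by ring] at b1
      rw [Nat.cast_succ, show (n : ℤ) + (k - 1) = n + k - 1 by ring,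
        show (n : ℤ) - (k - 1) = n + 1 - k by ring, show (n : ℤ) + (k + 1) = n + 1 + k by ring,
        show (n : ℤ) - (k + 1) = n - k - 1 by ring, a2, b2, a1, b1, hk1, hk,
        show 2 * (n + 1) = 2 * n + 1 + 1 by ring, Finset.prod_range_succ, Finset.prod_range_succ]
      have e1 : q ^ ((n : ℤ) + 1 + k) = q * (q ^ n * q ^ k) := by
        rw [zpow_add₀ hq0, zpow_add_one₀ hq0, zpow_natCast]; ring
      have e2 : q ^ ((n : ℤ) + k) = q ^ n * q ^ k := by
        rw [zpow_add₀ hq0, zpow_natCast]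
      have e3 : q ^ ((n : ℤ) + 1 - k) = q * (q ^ n / q ^ k) := by
        rw [zpow_sub₀ hq0, zpow_add_one₀ hq0, zpow_natCast]; ring
      have e4 : q ^ ((n : ℤ) - k) = q ^ n / q ^ k := by
        rw [zpow_sub₀ hq0, zpow_natCast]
      have e5 : q ^ (k - 1) = q ^ k / q := by rw [zpow_sub_one₀ hq0]; rfl
      rw [e1, e2, e3, e4, e5]
      have hqk : q ^ k ≠ 0 := zpow_ne_zero _ hq0
      field_simp
      ring
    · rw [Finset.prod_range_succ, Finset.prod_range_succ]
      field_simp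
      ring

/-- **Jacobi's triple product identity**. -/
theorem jacobi_triple_product {q z : ℂ} (hq : ‖q‖ < 1) (hq0 : q ≠ 0) (hz : z ≠ 0) :
    thetaSeries q z = qPochInf q q * (qPochInf q z * qPochInf q (q / z)) := by
  have hE : qPochInf q q ≠ 0 := qPochInf_ne_zero hq hq
  have hP := tendsto_prod_qPochInf hq q
  obtain ⟨A, hA⟩ := (Metric.isBounded_range_of_tendsto _ hP).exists_norm_le
  obtain ⟨B, hB⟩ := (Metric.isBounded_range_of_tendsto _
    (hP.inv₀ hE)).exists_norm_le
  have hA0 : 0 ≤ A := (norm_nonneg _).trans (hA _ ⟨0, rfl⟩)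
  have hB0 : 0 ≤ B := (norm_nonneg _).trans (hB _ ⟨0, rfl⟩)
  have hD : ∀ m, ‖invQFactorial q m‖ ≤ B := by
    intro m
    rw [invQFactorial]
    split_ifs
    · exact hB _ ⟨m.toNat, rfl⟩
    · simpa using hB0
  have hlim := tendsto_tsum_of_dominated_convergence (𝓕 := atTop)
    (f := fun (n : ℕ) (k : ℤ) => thetaTerm q z k *
      ((∏ j ∈ Finset.range (2 * n), (1 - q * q ^ j)) *
        (invQFactorial q (n + k) * invQFactorial q (n - k))))
    (g := fun k => thetaTerm q z k *
      (qPochInf q q * ((qPochInf q q)⁻¹ * (qPochInf q q)⁻¹)))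
    ((summable_thetaTerm hq hq0 hz).norm.mul_right (A * (B * B)))
    (fun k => by
      refine ((hP.comp (tendsto_id.const_mul_atTop' two_pos)).mul
        (((tendsto_invQFactorial hq).comp ?_).mul
          ((tendsto_invQFactorial hq).comp ?_))).const_mul _
      · exact tendsto_atTop_add_const_right _ _ tendsto_natCast_atTop_atTop
      · exact tendsto_atTop_add_const_right _ (-k) tendsto_natCast_atTop_atTop)
    (.of_forall fun n k => by
      rw [norm_mul, norm_mul, norm_mul]
      gcongr
      · exact hA _ ⟨2 * n, rfl⟩
      · exact hD _
      · exact hD _)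
  simp_rw [(hasSum_finite_triple_product hq hq0 hz _).tsum_eq] at hlim
  have h := tendsto_nhds_unique hlim
    ((tendsto_prod_qPochInf hq z).mul (tendsto_prod_qPochInf hq (q / z)))
  rw [tsum_mul_right] at h
  rw [← h, thetaSeries]
  field_simp

theorem bijective_parity_split : Function.Bijective (Sum.elim
    (fun x : ℤ × ℤ => (x.1 + x.2, x.1 - x.2)) fun x : ℤ × ℤ => (x.1 + x.2, x.1 - x.2 + 1)) := by
  constructor
  · rintro (⟨a, b⟩ | ⟨a, b⟩) (⟨c, d⟩ | ⟨c, d⟩) h <;>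
      simp only [Sum.elim_inl, Sum.elim_inr, Prod.mk.injEq, Sum.inl.injEq, Sum.inr.injEq,
        reduceCtorEq] at h ⊢ <;> lia
  · rintro ⟨m, n⟩
    rcases Int.even_or_odd' (m + n) with ⟨c, hc | hc⟩
    · exact ⟨.inl (c, m - c), by simp only [Sum.elim_inl, Prod.mk.injEq]; lia⟩
    · exact ⟨.inr (c, m - c), by simp only [Sum.elim_inr, Prod.mk.injEq]; lia⟩

theorem two_mul_mul_sub_one_ediv_two (k : ℤ) : 2 * (k * (k - 1) / 2) = k * (k - 1) :=
  Int.two_mul_ediv_two_of_even (Int.even_mul_pred_self k)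

theorem thetaTerm_sq {p : ℂ} (w : ℂ) (k : ℤ) :
    thetaTerm (p ^ 2) w k = p ^ (k * (k - 1)) * (-w) ^ k := by
  rw [thetaTerm, ← zpow_natCast, ← zpow_mul, Nat.cast_ofNat, two_mul_mul_sub_one_ediv_two]

theorem thetaTerm_mul_thetaTerm {p : ℂ} (hp0 : p ≠ 0) (a b : ℂ) {m n e : ℤ}
    (h : m * (m - 1) + n * (n - 1) = 2 * e) :
    thetaTerm p a m * thetaTerm p b n = p ^ e * ((-a) ^ m * (-b) ^ n) := by
  have he : e = m * (m - 1) / 2 + n * (n - 1) / 2 := by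
    linarith [two_mul_mul_sub_one_ediv_two m, two_mul_mul_sub_one_ediv_two n]
  rw [he, zpow_add₀ hp0, thetaTerm, thetaTerm]
  ring

theorem zpow_add_mul_zpow_sub {a b : ℂ} (ha : a ≠ 0) (hb : b ≠ 0) (i j : ℤ) :
    a ^ (i + j) * b ^ (i - j) = (a * b) ^ i * (a / b) ^ j := by
  rw [zpow_add₀ ha, zpow_sub₀ hb, mul_zpow, div_zpow]
  ring

theorem thetaSeries_mul_thetaSeries {p x y : ℂ} (hp : ‖p‖ < 1) (hp0 : p ≠ 0) (hx : x ≠ 0)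
    (hy : y ≠ 0) :
    thetaSeries p (x * y) * thetaSeries p (x / y) =
      thetaSeries (p ^ 2) (-x ^ 2) * thetaSeries (p ^ 2) (-(p * y ^ 2)) -
        x / y * (thetaSeries (p ^ 2) (-(p * x ^ 2)) * thetaSeries (p ^ 2) (-y ^ 2)) := by
  have hp2 := norm_pow_lt_one hp two_ne_zero
  have hp20 : p ^ 2 ≠ 0 := pow_ne_zero 2 hp0
  have hprod : ∀ {r a b : ℂ}, ‖r‖ < 1 → r ≠ 0 → a ≠ 0 → b ≠ 0 →
      HasSum (fun k : ℤ × ℤ => thetaTerm r a k.1 * thetaTerm r b k.2)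
        (thetaSeries r a * thetaSeries r b) := by
    intro r a b hr hr0 ha hb
    have h1 := summable_thetaTerm hr hr0 ha
    have h2 := summable_thetaTerm hr hr0 hb
    exact h1.hasSum.mul h2.hasSum (summable_mul_of_summable_norm h1.norm h2.norm)
  have hx2 : -x ^ 2 ≠ 0 := neg_ne_zero.mpr (pow_ne_zero 2 hx)
  have hy2 : -y ^ 2 ≠ 0 := neg_ne_zero.mpr (pow_ne_zero 2 hy)
  have hpx2 : -(p * x ^ 2) ≠ 0 := neg_ne_zero.mpr (mul_ne_zero hp0 (pow_ne_zero 2 hx))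
  have hpy2 : -(p * y ^ 2) ≠ 0 := neg_ne_zero.mpr (mul_ne_zero hp0 (pow_ne_zero 2 hy))
  have hL := hprod hp hp0 (mul_ne_zero hx hy) (div_ne_zero hx hy)
  have hA := hprod hp2 hp20 hx2 hpy2
  have hB := (hprod hp2 hp20 hpx2 hy2).mul_left (-(x / y))
  refine ((Equiv.ofBijective _ bijective_parity_split).hasSum_iff.mpr hL).unique ?_
  rw [sub_eq_add_neg, ← neg_mul (x / y)]
  have ha : -(x * y) ≠ 0 := neg_ne_zero.mpr (mul_ne_zero hx hy)
  have hb : -(x / y) ≠ 0 := neg_ne_zero.mpr (div_ne_zero hx hy)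
  have hab : -(x * y) * -(x / y) = x ^ 2 := by field_simp
  have hab' : -(x * y) / -(x / y) = y ^ 2 := by field_simp
  refine HasSum.sum ?_ ?_
  · convert! hA using 1
    funext ⟨i, j⟩
    simp only [Function.comp_apply, Equiv.ofBijective_apply, Sum.elim_inl]
    rw [thetaTerm_mul_thetaTerm hp0 _ _ (e := i * (i - 1) + j * (j - 1) + j) (by ring),
      zpow_add_mul_zpow_sub ha hb, hab, hab', thetaTerm_sq, thetaTerm_sq, neg_neg, neg_neg,
      mul_zpow, zpow_add₀ hp0, zpow_add₀ hp0]
    ring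
  · convert! hB using 1
    funext ⟨i, j⟩
    simp only [Function.comp_apply, Equiv.ofBijective_apply, Sum.elim_inr]
    rw [thetaTerm_mul_thetaTerm hp0 _ _ (e := i * (i - 1) + i + j * (j - 1)) (by ring),
      zpow_add_one₀ hb, ← mul_assoc ((-(x * y)) ^ _), zpow_add_mul_zpow_sub ha hb, hab, hab',
      thetaTerm_sq, thetaTerm_sq, neg_neg, neg_neg, mul_zpow, zpow_add₀ hp0, zpow_add₀ hp0]
    ring

/-- The **Weierstrass three-term relation** for theta series. -/
theorem thetaSeries_three_term {p x y u v : ℂ} (hp : ‖p‖ < 1) (hp0 : p ≠ 0) (hx : x ≠ 0)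
    (hy : y ≠ 0) (hu : u ≠ 0) (hv : v ≠ 0) :
    thetaSeries p (x * y) * thetaSeries p (x / y) *
        (thetaSeries p (u * v) * thetaSeries p (u / v)) -
      thetaSeries p (x * v) * thetaSeries p (x / v) *
        (thetaSeries p (u * y) * thetaSeries p (u / y)) =
      u / y * (thetaSeries p (y * v) * thetaSeries p (y / v) *
        (thetaSeries p (x * u) * thetaSeries p (x / u))) := by
  rw [thetaSeries_mul_thetaSeries hp hp0 hx hy, thetaSeries_mul_thetaSeries hp hp0 hu hv,
    thetaSeries_mul_thetaSeries hp hp0 hx hv, thetaSeries_mul_thetaSeries hp hp0 hu hy,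
    thetaSeries_mul_thetaSeries hp hp0 hy hv, thetaSeries_mul_thetaSeries hp hp0 hx hu]
  field_simp
  ring

theorem thetaSeries_inv {p z : ℂ} (hp : ‖p‖ < 1) (hp0 : p ≠ 0) (hz : z ≠ 0) :
    thetaSeries p z⁻¹ = -z⁻¹ * thetaSeries p z := by
  rw [jacobi_triple_product hp hp0 hz, jacobi_triple_product hp hp0 (inv_ne_zero hz),
    qPochInf_eq_one_sub_mul hp z, qPochInf_eq_one_sub_mul hp z⁻¹,
    show z⁻¹ * p = p / z by ring, show p / z⁻¹ = z * p by field_simp]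
  field_simp
  ring

theorem thetaSeries_neg_one {p : ℂ} (hp : ‖p‖ < 1) (hp0 : p ≠ 0) :
    thetaSeries p (-1) = 2 * qPochInf p p * qPochInf p (-p) ^ 2 := by
  rw [jacobi_triple_product hp hp0 (neg_ne_zero.mpr one_ne_zero), qPochInf_eq_one_sub_mul hp (-1),
    show -1 * p = -p by ring, show p / -1 = -p by ring]
  ring

/-- The two three-term relations behind the identity, combined. -/
theorem thetaSeries_relation {q : ℂ} (hq : ‖q‖ < 1) (hq0 : q ≠ 0) :
    thetaSeries (q ^ 10) (q ^ 5) * thetaSeries (q ^ 10) (-1) *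
      (thetaSeries (q ^ 10) (q ^ 3) * thetaSeries (q ^ 10) (-q ^ 4) -
        q * (thetaSeries (q ^ 10) q * thetaSeries (q ^ 10) (-q ^ 2))) =
      2 * (thetaSeries (q ^ 10) q * thetaSeries (q ^ 10) (q ^ 3) *
        (thetaSeries (q ^ 10) (-q ^ 2) * thetaSeries (q ^ 10) (-q ^ 4))) := by
  have hp := norm_pow_lt_one hq (n := 10) (by norm_num)
  have hp0 : q ^ 10 ≠ 0 := pow_ne_zero 10 hq0
  have hpow (n : ℕ) : q ^ n ≠ 0 := pow_ne_zero n hq0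
  have hsymm : ∀ {z w : ℂ}, z ≠ 0 → w ≠ 0 → z * w = q ^ 10 →
      thetaSeries (q ^ 10) z = thetaSeries (q ^ 10) w := by
    intro z w hz hw hzw
    rw [jacobi_triple_product hp hp0 hz, jacobi_triple_product hp hp0 hw, ← hzw,
      mul_div_cancel_left₀ _ hz, mul_div_cancel_right₀ _ hw, mul_comm (qPochInf _ z)]
  have h1 := thetaSeries_three_term hp hp0 (hpow 4) hq0 (hpow 2) (neg_ne_zero.mpr (hpow 2))
  have h2 := thetaSeries_three_term hp hp0 (hpow 2) (hpow 3) hq0 (neg_ne_zero.mpr hq0)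
  rw [show q ^ 4 * q = q ^ 5 by ring, show q ^ 4 / q = q ^ 3 by field_simp,
    show q ^ 2 * -q ^ 2 = -q ^ 4 by ring, show q ^ 2 / -q ^ 2 = -1 by field_simp,
    show q ^ 4 * -q ^ 2 = -q ^ 6 by ring, show q ^ 4 / -q ^ 2 = -q ^ 2 by field_simp,
    show q ^ 2 * q = q ^ 3 by ring, show q ^ 2 / q = q by field_simp,
    show q * -q ^ 2 = -q ^ 3 by ring, show q / -q ^ 2 = (-q)⁻¹ by field_simp,
    show q ^ 4 * q ^ 2 = q ^ 6 by ring, show q ^ 4 / q ^ 2 = q ^ 2 by field_simp,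
    thetaSeries_inv hp hp0 (neg_ne_zero.mpr hq0),
    hsymm (hpow 6) (hpow 4) (by ring),
    hsymm (neg_ne_zero.mpr (hpow 6)) (neg_ne_zero.mpr (hpow 4)) (by ring)] at h1
  rw [show q ^ 2 * q ^ 3 = q ^ 5 by ring, show q ^ 2 / q ^ 3 = q⁻¹ by field_simp,
    show q * -q = -q ^ 2 by ring, show q / -q = -1 by field_simp,
    show q ^ 2 * -q = -q ^ 3 by ring, show q ^ 2 / -q = -q by field_simp,
    show q * q ^ 3 = q ^ 4 by ring, show q / q ^ 3 = (q ^ 2)⁻¹ by field_simp,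
    show q ^ 3 * -q = -q ^ 4 by ring, show q ^ 3 / -q = -q ^ 2 by field_simp,
    show q ^ 2 * q = q ^ 3 by ring, show q ^ 2 / q = q by field_simp,
    thetaSeries_inv hp hp0 hq0, thetaSeries_inv hp hp0 (hpow 2)] at h2
  field_simp at h1 h2
  linear_combination h1 + h2

theorem qPochInf_relation {q : ℂ} (hq : ‖q‖ < 1) (hq0 : q ≠ 0) :
    qPochInf (q ^ 10) (q ^ 5) ^ 2 * qPochInf (q ^ 10) (-q ^ 10) ^ 2 *
      (qPochInf (q ^ 10) (q ^ 3) * qPochInf (q ^ 10) (q ^ 7) *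
          (qPochInf (q ^ 10) (-q ^ 4) * qPochInf (q ^ 10) (-q ^ 6)) -
        q * (qPochInf (q ^ 10) q * qPochInf (q ^ 10) (q ^ 9) *
          (qPochInf (q ^ 10) (-q ^ 2) * qPochInf (q ^ 10) (-q ^ 8)))) =
      qPochInf (q ^ 10) q * qPochInf (q ^ 10) (q ^ 9) *
        (qPochInf (q ^ 10) (q ^ 3) * qPochInf (q ^ 10) (q ^ 7)) *
        (qPochInf (q ^ 10) (-q ^ 2) * qPochInf (q ^ 10) (-q ^ 8) *
          (qPochInf (q ^ 10) (-q ^ 4) * qPochInf (q ^ 10) (-q ^ 6))) := by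
  have hp := norm_pow_lt_one hq (n := 10) (by norm_num)
  have hp0 : q ^ 10 ≠ 0 := pow_ne_zero 10 hq0
  have hpow (n : ℕ) : q ^ n ≠ 0 := pow_ne_zero n hq0
  have hE : qPochInf (q ^ 10) (q ^ 10) ≠ 0 := qPochInf_ne_zero hp hp
  have h := thetaSeries_relation hq hq0
  rw [thetaSeries_neg_one hp hp0, jacobi_triple_product hp hp0 (hpow 5),
    jacobi_triple_product hp hp0 (hpow 3), jacobi_triple_product hp hp0 hq0,
    jacobi_triple_product hp hp0 (neg_ne_zero.mpr (hpow 2)),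
    jacobi_triple_product hp hp0 (neg_ne_zero.mpr (hpow 4)),
    show q ^ 10 / q ^ 5 = q ^ 5 by field_simp, show q ^ 10 / q ^ 3 = q ^ 7 by field_simp,
    show q ^ 10 / q = q ^ 9 by field_simp, show q ^ 10 / -q ^ 2 = -q ^ 8 by field_simp,
    show q ^ 10 / -q ^ 4 = -q ^ 6 by field_simp] at h
  refine mul_left_cancel₀ (mul_ne_zero two_ne_zero (pow_ne_zero 4 hE)) ?_
  linear_combination h

/-- One of Ramanujan's forty identities:
$G(q)G(q^4)-qH(q)H(q^4) = (q^{10};q^{10})_\infty^5/((q^2;q^2)_\infty(q^5;q^5)_\infty^2(q^{20};q^{20})_\infty^2)$. -/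
theorem GH_minus (q : ℂ) (hq : ‖q‖ < 1) :
    RRG q * RRG (q ^ 4) - q * RRH q * RRH (q ^ 4)
      = qPochInf (q ^ 10) (q ^ 10) ^ 5 /
          (qPochInf (q ^ 2) (q ^ 2) * qPochInf (q ^ 5) (q ^ 5) ^ 2 *
            qPochInf (q ^ 20) (q ^ 20) ^ 2) := by
  rcases eq_or_ne q 0 with rfl | hq0
  · simp [RRG, RRH, qPochInf]
  have hp := norm_pow_lt_one hq (n := 10) (by norm_num)
  have hne (n : ℕ) (hn : n ≠ 0) : qPochInf (q ^ 10) (q ^ n) ≠ 0 :=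
    qPochInf_ne_zero hp (norm_pow_lt_one hq hn)
  have hne' (n : ℕ) (hn : n ≠ 0) : qPochInf (q ^ 10) (-q ^ n) ≠ 0 :=
    qPochInf_ne_zero hp (by simpa only [norm_neg] using norm_pow_lt_one hq hn)
  have split5 (n : ℕ) : qPochInf (q ^ 5) (q ^ n) =
      qPochInf (q ^ 10) (q ^ n) * qPochInf (q ^ 10) (q ^ (n + 5)) := by
    rw [qPochInf_eq_prod_residues (norm_pow_lt_one hq (by norm_num)) _ two_ne_zero]
    simp [Finset.prod_range_succ, ← pow_mul, ← pow_add]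
  have split20 (n : ℕ) : qPochInf (q ^ 20) (q ^ (n * 2)) =
      qPochInf (q ^ 10) (q ^ n) * qPochInf (q ^ 10) (-q ^ n) := by
    rw [qPochInf_mul_neg hp, ← pow_mul, ← pow_mul]
  have split2 : qPochInf (q ^ 2) (q ^ 2) =
      qPochInf (q ^ 10) (q ^ 2) * qPochInf (q ^ 10) (q ^ 4) * qPochInf (q ^ 10) (q ^ 6) *
        qPochInf (q ^ 10) (q ^ 8) * qPochInf (q ^ 10) (q ^ 10) := by
    rw [qPochInf_eq_prod_residues (norm_pow_lt_one hq two_ne_zero) _ (m := 5) (by norm_num)]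
    simp [Finset.prod_range_succ, ← pow_mul, ← pow_add]
  have hrel := qPochInf_relation hq hq0
  have h5_1 := split5 1
  have h1 := hne 1 one_ne_zero
  rw [pow_one] at h5_1 h1
  simp only [RRG, RRH, ← pow_mul, Nat.reduceMul]
  rw [h5_1, split5 4, split5 2, split5 3, split5 5, split20 2, split20 8, split20 4, split20 6,
    split20 10, split2]
  simp only [Nat.reduceAdd]
  have h2 := hne 2 (by norm_num)
  have h3 := hne 3 (by norm_num)
  have h4 := hne 4 (by norm_num)
  have h5 := hne 5 (by norm_num)
  have h6 := hne 6 (by norm_num)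
  have h7 := hne 7 (by norm_num)
  have h8 := hne 8 (by norm_num)
  have h9 := hne 9 (by norm_num)
  have h10 := hne 10 (by norm_num)
  have h2' := hne' 2 (by norm_num)
  have h4' := hne' 4 (by norm_num)
  have h6' := hne' 6 (by norm_num)
  have h8' := hne' 8 (by norm_num)
  have h10' := hne' 10 (by norm_num)
  field_simp
  linear_combination hrel
end

section
/- E(q²)⁷E(q³)E(q^{12}) / (E(q)³E(q⁴)³E(q⁶)) + 2E(q⁴)³E(q⁶)² / (E(q²)²E(q^{12})) = 3E(q³)³/E(q), where E(q) = (q;q)_∞ = ∏_{j≥1}(1-q^j). -/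
open scoped BigOperators

/-- Euler function $E(q) = (q;q)_\infty = \prod_{j\ge1}(1-q^j)$. -/
noncomputable def eulerE (q : ℂ) : ℂ := ∏' j : ℕ, (1 - q * q ^ j)

open Filter Topology

/-! ### Infinite `q`-Pochhammer symbols -/

/-- The infinite `q`-Pochhammer symbol `(x; q)_∞ = ∏_{j ≥ 0} (1 - x q ^ j)`. -/
noncomputable def qPoch (x q : ℂ) : ℂ := ∏' j : ℕ, (1 - x * q ^ j)

theorem eulerE_eq_qPoch (q : ℂ) : eulerE q = qPoch q q := rfl

theorem summable_norm_mul_pow (x : ℂ) {q : ℂ} (hq : ‖q‖ < 1) :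
    Summable fun j : ℕ ↦ ‖-(x * q ^ j)‖ := by
  simpa using (summable_geometric_of_lt_one (norm_nonneg _) hq).mul_left ‖x‖

theorem multipliable_qPoch (x : ℂ) {q : ℂ} (hq : ‖q‖ < 1) :
    Multipliable fun j : ℕ ↦ 1 - x * q ^ j := by
  simpa [sub_eq_add_neg] using multipliable_one_add_of_summable (summable_norm_mul_pow x hq)

theorem tendsto_qPoch (x : ℂ) {q : ℂ} (hq : ‖q‖ < 1) :
    Tendsto (fun n ↦ ∏ j ∈ Finset.range n, (1 - x * q ^ j)) atTop (𝓝 (qPoch x q)) :=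
  (multipliable_qPoch x hq).hasProd.tendsto_prod_nat

theorem qPoch_ne_zero {x q : ℂ} (hq : ‖q‖ < 1) (hx : ∀ j : ℕ, x * q ^ j ≠ 1) :
    qPoch x q ≠ 0 := by
  have := tprod_one_add_ne_zero_of_summable (f := fun j : ℕ ↦ -(x * q ^ j))
    (fun j h ↦ hx j (by linear_combination -h)) (summable_norm_mul_pow x hq)
  simpa [qPoch, sub_eq_add_neg] using this

theorem qPoch_ne_zero_of_norm_lt_one {x q : ℂ} (hq : ‖q‖ < 1) (hx : ‖x‖ < 1) :
    qPoch x q ≠ 0 := by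
  refine qPoch_ne_zero hq fun j h ↦ ?_
  have h1 : ‖x * q ^ j‖ < 1 := by
    rw [norm_mul, norm_pow]
    exact mul_lt_one_of_nonneg_of_lt_one_left (norm_nonneg _) hx
      (pow_le_one₀ (norm_nonneg _) hq.le)
  simp [h] at h1

theorem eulerE_ne_zero {q : ℂ} (hq : ‖q‖ < 1) : eulerE q ≠ 0 :=
  qPoch_ne_zero_of_norm_lt_one hq hq

theorem qPoch_eq_mul_two (x : ℂ) {q : ℂ} (hq : ‖q‖ < 1) :
    qPoch x q = qPoch x (q ^ 2) * qPoch (x * q) (q ^ 2) := by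
  have hq2 := norm_pow_lt_one hq two_ne_zero
  have h := (tendsto_qPoch x hq).comp
    (tendsto_id.const_mul_atTop' (zero_lt_two' ℕ))
  refine tendsto_nhds_unique h
    (((tendsto_qPoch x hq2).mul (tendsto_qPoch (x * q) hq2)).congr fun n ↦ ?_)
  induction n with
  | zero => simp
  | succ n ih =>
    simp only [Function.comp, id, show 2 * (n + 1) = 2 * n + 1 + 1 by ring,
      Finset.prod_range_succ] at ih ⊢
    rw [← ih]
    ring

theorem qPoch_eq_mul_three (x : ℂ) {q : ℂ} (hq : ‖q‖ < 1) :
    qPoch x q = qPoch x (q ^ 3) * qPoch (x * q) (q ^ 3) * qPoch (x * q ^ 2) (q ^ 3) := by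
  have hq3 := norm_pow_lt_one hq three_ne_zero
  have h := (tendsto_qPoch x hq).comp
    (tendsto_id.const_mul_atTop' (zero_lt_three' ℕ))
  refine tendsto_nhds_unique h
    ((((tendsto_qPoch x hq3).mul (tendsto_qPoch (x * q) hq3)).mul
      (tendsto_qPoch (x * q ^ 2) hq3)).congr fun n ↦ ?_)
  induction n with
  | zero => simp
  | succ n ih =>
    simp only [Function.comp, id, show 3 * (n + 1) = 3 * n + 1 + 1 + 1 by ring,
      Finset.prod_range_succ] at ih ⊢
    rw [← ih]
    ring

theorem qPoch_mul_qPoch_neg (x : ℂ) {q : ℂ} (hq : ‖q‖ < 1) :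
    qPoch x q * qPoch (-x) q = qPoch (x ^ 2) (q ^ 2) := by
  rw [qPoch, qPoch, qPoch,
    ← (multipliable_qPoch x hq).tprod_mul (multipliable_qPoch (-x) hq)]
  exact tprod_congr fun j ↦ by ring

theorem qPoch_eq_one_sub_mul (x : ℂ) {q : ℂ} (hq : ‖q‖ < 1) :
    qPoch x q = (1 - x) * qPoch (x * q) q := by
  have h := (tendsto_qPoch x hq).comp (tendsto_add_atTop_nat 1)
  refine tendsto_nhds_unique h (((tendsto_qPoch (x * q) hq).const_mul (1 - x)).congr fun n ↦ ?_)
  simp only [Function.comp, Finset.prod_range_succ', pow_zero, mul_one]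
  rw [mul_comm]
  congr 1
  exact Finset.prod_congr rfl fun j _ ↦ by ring

theorem continuousAt_eulerE_zero : ContinuousAt eulerE 0 := by
  have h := (ModularForm.differentiableOn_tprod_one_sub_pow.differentiableAt
    (Metric.ball_mem_nhds (0 : ℂ) one_pos)).continuousAt
  exact h.congr (Eventually.of_forall fun q ↦ tprod_congr fun j ↦ by ring)

theorem eulerE_zero : eulerE 0 = 1 := by simp [eulerE]

/-! ### The Jacobi triple product -/

/-- The reciprocal `1 / (r; r)_m` of the finite `q`-Pochhammer symbol, extended by zero to
negative `m`. -/
noncomputable def invFinPoch (r : ℂ) (m : ℤ) : ℂ :=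
  if m < 0 then 0 else (∏ j ∈ Finset.range m.toNat, (1 - r * r ^ j))⁻¹

theorem one_sub_mul_pow_ne_zero_s10 {r : ℂ} (hr : ‖r‖ < 1) (j : ℕ) : 1 - r * r ^ j ≠ 0 := by
  intro h
  have h1 := norm_pow_lt_one hr j.succ_ne_zero
  rw [pow_succ', ← sub_eq_zero.mp h] at h1
  simp at h1

theorem invFinPoch_sub_one {r : ℂ} (hr : ‖r‖ < 1) (m : ℤ) :
    invFinPoch r (m - 1) = (1 - r ^ m) * invFinPoch r m := by
  rcases lt_trichotomy m 0 with h | rfl | h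
  · simp [invFinPoch, h, show m - 1 < 0 by lia]
  · simp [invFinPoch]
  · obtain ⟨k, rfl⟩ : ∃ k : ℕ, m = k + 1 := ⟨(m - 1).toNat, by lia⟩
    have h1 := one_sub_mul_pow_ne_zero_s10 hr k
    have h2 : ¬ ((k : ℤ) + 1 < 0) := by lia
    have h3 : ((k : ℤ) + 1).toNat = k + 1 := by lia
    have h4 : r ^ ((k : ℤ) + 1) = r * r ^ k := by
      rw [← pow_succ']
      exact_mod_cast zpow_natCast r (k + 1)
    simp only [invFinPoch, add_sub_cancel_right, h2, h3, h4, Finset.prod_range_succ, mul_inv]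
    simp only [Int.toNat_natCast, if_neg (not_lt.mpr k.cast_nonneg), if_false]
    field_simp

theorem tendsto_invFinPoch {r : ℂ} (hr : ‖r‖ < 1) :
    Tendsto (invFinPoch r) atTop (𝓝 (eulerE r)⁻¹) := by
  have h := ((tendsto_qPoch r hr).inv₀ (eulerE_ne_zero hr)).comp
    (tendsto_atTop_atTop.mpr fun b ↦ ⟨(b : ℤ), fun a ha ↦ by lia⟩ :
      Tendsto Int.toNat atTop atTop)
  refine h.congr' ?_
  filter_upwards [eventually_ge_atTop 0] with m hm
  simp [invFinPoch, not_lt.mpr hm]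

theorem exists_norm_invFinPoch_le {r : ℂ} (hr : ‖r‖ < 1) : ∃ C, ∀ m, ‖invFinPoch r m‖ ≤ C := by
  obtain ⟨C, hC⟩ := ((tendsto_qPoch r hr).inv₀ (eulerE_ne_zero hr)).norm.bddAbove_range
  refine ⟨C, fun m ↦ ?_⟩
  have h0 := hC ⟨0, rfl⟩
  by_cases h : m < 0
  · simpa [invFinPoch, h] using le_trans (norm_nonneg _) h0
  · simpa [invFinPoch, h] using hC ⟨m.toNat, rfl⟩

/-- The coefficient of `x ^ j` in `∏_{k < n} (1 + x q ^ (2k+1)) (1 + x⁻¹ q ^ (2k+1))`. -/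
noncomputable def tripleCoeff (q : ℂ) (n : ℕ) (j : ℤ) : ℂ :=
  q ^ (j ^ 2) * (∏ i ∈ Finset.range (2 * n), (1 - q ^ 2 * (q ^ 2) ^ i)) *
    (invFinPoch (q ^ 2) (n - j) * invFinPoch (q ^ 2) (n + j))

theorem tripleCoeff_succ {q : ℂ} (hq0 : q ≠ 0) (hq : ‖q‖ < 1) (n : ℕ) (j : ℤ) :
    tripleCoeff q (n + 1) j = (1 + q ^ (4 * n + 2)) * tripleCoeff q n j +
      q ^ (2 * n + 1) * (tripleCoeff q n (j - 1) + tripleCoeff q n (j + 1)) := by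
  have hr := norm_pow_lt_one hq two_ne_zero
  have e (m : ℤ) := invFinPoch_sub_one hr m
  set g := invFinPoch (q ^ 2)
  have a1 : g (n - j) = (1 - (q ^ 2) ^ ((n : ℤ) + 1 - j)) * g (n + 1 - j) := by
    rw [← e]; congr 1; ring
  have a2 : g (n - j - 1) = (1 - (q ^ 2) ^ ((n : ℤ) - j)) * g (n - j) := e _
  have b1 : g (n + j) = (1 - (q ^ 2) ^ ((n : ℤ) + 1 + j)) * g (n + 1 + j) := by
    rw [← e]; congr 1; ring
  have b2 : g (n + j - 1) = (1 - (q ^ 2) ^ ((n : ℤ) + j)) * g (n + j) := e _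
  have s1 : ((n : ℤ) - (j - 1)) = n + 1 - j := by ring
  have s2 : ((n : ℤ) + (j - 1)) = n + j - 1 := by ring
  have s3 : ((n : ℤ) - (j + 1)) = n - j - 1 := by ring
  have s4 : ((n : ℤ) + (j + 1)) = n + 1 + j := by ring
  have p1 : q ^ ((j - 1) ^ 2) = q ^ (j ^ 2) * q / (q ^ j) ^ 2 := by
    rw [eq_div_iff (by positivity), ← zpow_natCast, ← zpow_mul, ← zpow_add₀ hq0, ← zpow_add_one₀ hq0]
    congr 1; push_cast; ring
  have p2 : q ^ ((j + 1) ^ 2) = q ^ (j ^ 2) * q * (q ^ j) ^ 2 := by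
    rw [← zpow_natCast (q ^ j), ← zpow_mul, ← zpow_add_one₀ hq0, ← zpow_add₀ hq0]
    congr 1; push_cast; ring
  have hqj : q ^ j ≠ 0 := zpow_ne_zero _ hq0
  have hqq : q ^ 2 ≠ 0 := pow_ne_zero _ hq0
  have hj : (q ^ 2) ^ j = (q ^ j) ^ 2 := by
    rw [← zpow_natCast, ← zpow_natCast, ← zpow_mul, ← zpow_mul, mul_comm]
  simp only [tripleCoeff, Nat.cast_add, Nat.cast_one, s1, s2, s3, s4]
  rw [show invFinPoch (q ^ 2) = g from rfl, a2, b2, a1, b1, p1, p2]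
  simp only [zpow_sub₀ hqq, zpow_add₀ hqq, zpow_natCast, zpow_one, hj]
  rw [show 2 * (n + 1) = 2 * n + 1 + 1 by ring, Finset.prod_range_succ, Finset.prod_range_succ]
  generalize q ^ j = J at *
  generalize g (n + 1 - j) = A
  generalize g (n + 1 + j) = B
  generalize q ^ (j ^ 2) = K
  field_simp
  ring

theorem hasSum_tripleCoeff {q x : ℂ} (hq0 : q ≠ 0) (hq : ‖q‖ < 1) (hx : x ≠ 0) (n : ℕ) :
    HasSum (fun j : ℤ ↦ tripleCoeff q n j * x ^ j)
      ((∏ k ∈ Finset.range n, (1 - -(x * q) * (q ^ 2) ^ k)) *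
        ∏ k ∈ Finset.range n, (1 - -(x⁻¹ * q) * (q ^ 2) ^ k)) := by
  induction n with
  | zero =>
    have := hasSum_single (f := fun j : ℤ ↦ tripleCoeff q 0 j * x ^ j) 0 fun j hj ↦ by
      rcases lt_or_gt_of_ne hj with h | h <;> simp [tripleCoeff, invFinPoch, h]
    simpa [tripleCoeff, invFinPoch] using this
  | succ n ih =>
    have h1 := ((Equiv.subRight (1 : ℤ)).hasSum_iff.mpr ih).mul_left x
    have h2 := ((Equiv.addRight (1 : ℤ)).hasSum_iff.mpr ih).mul_left x⁻¹
    have h := (ih.mul_left (1 + q ^ (4 * n + 2))).add ((h1.add h2).mul_left (q ^ (2 * n + 1)))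
    convert h using 1
    · rfl
    · funext j
      simp only [Function.comp, Equiv.subRight_apply, Equiv.coe_addRight,
        tripleCoeff_succ hq0 hq, zpow_sub_one₀ hx, zpow_add_one₀ hx]
      field_simp
    · simp only [Finset.prod_range_succ]
      field_simp
      ring

theorem summable_norm_theta {q x : ℂ} (hq0 : q ≠ 0) (hq : ‖q‖ < 1) (hx : x ≠ 0) :
    Summable fun n : ℤ ↦ ‖q ^ (n ^ 2) * x ^ n‖ := by
  have hpi : (Real.pi : ℂ) * Complex.I ≠ 0 := by simp [Real.pi_ne_zero]
  have him : 0 < (Complex.log q / (Real.pi * Complex.I)).im := by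
    have : Complex.log q / (Real.pi * Complex.I) = -(Complex.log q / Real.pi) * Complex.I := by
      field_simp
      simp
    rw [this]
    simp only [Complex.mul_I_im, Complex.neg_re, Complex.div_ofReal_re, Complex.log_re]
    have := Real.log_neg (norm_pos_iff.mpr hq0) hq
    have := div_neg_of_neg_of_pos this Real.pi_pos
    linarith
  have h := (summable_jacobiTheta₂_term_iff
    (Complex.log x / (2 * Real.pi * Complex.I)) _).mpr him
  refine h.norm.congr fun n ↦ ?_
  congr 1
  have e1 : 2 * (Real.pi : ℂ) * Complex.I * n * (Complex.log x / (2 * Real.pi * Complex.I)) =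
      n * Complex.log x := by field_simp
  have e2 : (Real.pi : ℂ) * Complex.I * n ^ 2 * (Complex.log q / (Real.pi * Complex.I)) =
      ((n ^ 2 : ℤ) : ℂ) * Complex.log q := by
    push_cast
    field_simp
  rw [jacobiTheta₂_term, e1, e2, Complex.exp_add, Complex.exp_int_mul, Complex.exp_int_mul,
    Complex.exp_log hx, Complex.exp_log hq0, mul_comm]

/-- The Jacobi triple product identity. -/
theorem tsum_theta_eq {q x : ℂ} (hq0 : q ≠ 0) (hq : ‖q‖ < 1) (hx : x ≠ 0) :
    ∑' n : ℤ, q ^ (n ^ 2) * x ^ n =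
      eulerE (q ^ 2) * qPoch (-(x * q)) (q ^ 2) * qPoch (-(x⁻¹ * q)) (q ^ 2) := by
  have hr := norm_pow_lt_one hq two_ne_zero
  have hE := eulerE_ne_zero hr
  obtain ⟨C, hC⟩ := exists_norm_invFinPoch_le hr
  obtain ⟨B, hB⟩ := (tendsto_qPoch (q ^ 2) hr).norm.bddAbove_range
  have hB' (n : ℕ) : ‖∏ i ∈ Finset.range n, (1 - q ^ 2 * (q ^ 2) ^ i)‖ ≤ B := hB ⟨n, rfl⟩
  have hC0 : 0 ≤ C := (norm_nonneg _).trans (hC 0)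
  have hB0 : 0 ≤ B := (norm_nonneg _).trans (hB' 0)
  have lim : Tendsto (fun n : ℕ ↦ ∑' j : ℤ, tripleCoeff q n j * x ^ j) atTop
      (𝓝 (∑' j : ℤ, q ^ (j ^ 2) * x ^ j * (eulerE (q ^ 2))⁻¹)) := by
    refine tendsto_tsum_of_dominated_convergence
      ((summable_norm_theta hq0 hq hx).mul_right (B * (C * C))) (fun j ↦ ?_)
      (Eventually.of_forall fun n j ↦ ?_)
    · have h1 := (tendsto_qPoch (q ^ 2) hr).comp
        (tendsto_id.const_mul_atTop' (zero_lt_two' ℕ))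
      have h2 := (tendsto_invFinPoch hr).comp
        (tendsto_atTop_add_const_right _ (-j) (tendsto_natCast_atTop_atTop (R := ℤ)))
      have h3 := (tendsto_invFinPoch hr).comp
        (tendsto_atTop_add_const_right _ j (tendsto_natCast_atTop_atTop (R := ℤ)))
      have h := ((h1.const_mul (q ^ (j ^ 2))).mul (h2.mul h3)).mul_const (x ^ j)
      rw [← eulerE_eq_qPoch] at h
      convert h using 2
      · simp [tripleCoeff, sub_eq_add_neg]
      · field_simp
    · rw [tripleCoeff, norm_mul, norm_mul, norm_mul, norm_mul, norm_mul]
      calc _ = ‖q ^ (j ^ 2)‖ * ‖x ^ j‖ *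
            (‖∏ i ∈ Finset.range (2 * n), (1 - q ^ 2 * (q ^ 2) ^ i)‖ *
              (‖invFinPoch (q ^ 2) (n - j)‖ * ‖invFinPoch (q ^ 2) (n + j)‖)) := by ring
        _ ≤ _ := by
          gcongr
          · exact hB' _
          · exact hC _
          · exact hC _
  have lim' := (tendsto_qPoch (-(x * q)) hr).mul (tendsto_qPoch (-(x⁻¹ * q)) hr)
  have key := tendsto_nhds_unique lim
    (lim'.congr fun n ↦ (hasSum_tripleCoeff hq0 hq hx n).tsum_eq.symm)
  rw [tsum_mul_right, ← div_eq_mul_inv, div_eq_iff hE] at key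
  rw [key]
  ring

/-! ### Theta series with quadratic exponents -/

/-- The theta series `∑_{n ∈ ℤ} σ ^ n q ^ (a n² + b n)`. -/
noncomputable def quadTheta (σ q : ℂ) (a b : ℤ) : ℂ := ∑' n : ℤ, σ ^ n * q ^ (a * n ^ 2 + b * n)

theorem quadTheta_term {σ q : ℂ} (hq0 : q ≠ 0) (a b n : ℤ) :
    σ ^ n * q ^ (a * n ^ 2 + b * n) = (q ^ a) ^ (n ^ 2) * (σ * q ^ b) ^ n := by
  rw [zpow_add₀ hq0, mul_zpow, zpow_mul, zpow_mul]
  ring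

theorem norm_zpow_lt_one {q : ℂ} (hq : ‖q‖ < 1) {a : ℤ} (ha : 0 < a) : ‖q ^ a‖ < 1 := by
  lift a to ℕ using ha.le
  rw [zpow_natCast]
  exact norm_pow_lt_one hq (by lia)

theorem summable_norm_quadTheta {σ q : ℂ} (hσ : σ ≠ 0) (hq0 : q ≠ 0) (hq : ‖q‖ < 1) {a : ℤ}
    (ha : 0 < a) (b : ℤ) : Summable fun n : ℤ ↦ ‖σ ^ n * q ^ (a * n ^ 2 + b * n)‖ := by
  simp_rw [quadTheta_term hq0]
  exact summable_norm_theta (zpow_ne_zero _ hq0) (norm_zpow_lt_one hq ha)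
    (mul_ne_zero hσ (zpow_ne_zero _ hq0))

theorem quadTheta_eq {σ q : ℂ} (hσ : σ ≠ 0) (hq0 : q ≠ 0) (hq : ‖q‖ < 1) {a : ℤ}
    (ha : 0 < a) (b : ℤ) :
    quadTheta σ q a b = eulerE (q ^ (2 * a)) * qPoch (-(σ * q ^ (a + b))) (q ^ (2 * a)) *
      qPoch (-(σ⁻¹ * q ^ (a - b))) (q ^ (2 * a)) := by
  have e : (q ^ a) ^ 2 = q ^ (2 * a) := by
    rw [mul_comm, zpow_mul]
    rfl
  simp_rw [quadTheta, quadTheta_term hq0]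
  rw [tsum_theta_eq (zpow_ne_zero _ hq0) (norm_zpow_lt_one hq ha)
    (mul_ne_zero hσ (zpow_ne_zero _ hq0)), e, mul_inv, zpow_add₀ hq0, zpow_sub₀ hq0]
  congr 3 <;> field_simp

theorem summable_quadTheta_mul {σ τ q : ℂ} (hσ : σ ≠ 0) (hτ : τ ≠ 0) (hq0 : q ≠ 0)
    (hq : ‖q‖ < 1) {a c : ℤ} (ha : 0 < a) (hc : 0 < c) (b d : ℤ) :
    Summable fun p : ℤ × ℤ ↦
      σ ^ p.1 * τ ^ p.2 * q ^ (a * p.1 ^ 2 + b * p.1 + (c * p.2 ^ 2 + d * p.2)) := by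
  refine (summable_mul_of_summable_norm (summable_norm_quadTheta hσ hq0 hq ha b)
    (summable_norm_quadTheta hτ hq0 hq hc d)).congr fun p ↦ ?_
  rw [zpow_add₀ hq0 (a * p.1 ^ 2 + b * p.1)]
  ring

theorem quadTheta_mul {σ τ q : ℂ} (hσ : σ ≠ 0) (hτ : τ ≠ 0) (hq0 : q ≠ 0)
    (hq : ‖q‖ < 1) {a c : ℤ} (ha : 0 < a) (hc : 0 < c) (b d : ℤ) :
    quadTheta σ q a b * quadTheta τ q c d = ∑' p : ℤ × ℤ,
      σ ^ p.1 * τ ^ p.2 * q ^ (a * p.1 ^ 2 + b * p.1 + (c * p.2 ^ 2 + d * p.2)) := by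
  rw [quadTheta, quadTheta, tsum_mul_tsum_of_summable_norm
    (summable_norm_quadTheta hσ hq0 hq ha b) (summable_norm_quadTheta hτ hq0 hq hc d)]
  refine tsum_congr fun p ↦ ?_
  rw [zpow_add₀ hq0 (a * p.1 ^ 2 + b * p.1)]
  ring

theorem injective_add_sub : Function.Injective fun p : ℤ × ℤ ↦ (p.1 + p.2, p.1 - p.2) := by
  rintro ⟨s, t⟩ ⟨s', t'⟩ h
  simp only [Prod.mk.injEq] at h ⊢
  lia

theorem injective_add_sub_one :
    Function.Injective fun p : ℤ × ℤ ↦ (p.1 + p.2 - 1, p.1 - p.2) := by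
  rintro ⟨s, t⟩ ⟨s', t'⟩ h
  simp only [Prod.mk.injEq] at h ⊢
  lia

/-- Splitting a double series according to the parity of the sum of the indices. -/
theorem tsum_eq_add_of_parity {F : ℤ × ℤ → ℂ} (hF : Summable F) :
    ∑' p, F p = ∑' p : ℤ × ℤ, F (p.1 + p.2, p.1 - p.2) +
      ∑' p : ℤ × ℤ, F (p.1 + p.2 - 1, p.1 - p.2) := by
  have h1 := (injective_add_sub.hasSum_range_iff (f := F)).mpr
    (hF.comp_injective injective_add_sub).hasSum
  have h2 := (injective_add_sub_one.hasSum_range_iff (f := F)).mpr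
    (hF.comp_injective injective_add_sub_one).hasSum
  refine (HasSum.add_isCompl ⟨?_, ?_⟩ h1 h2).tsum_eq
  · rw [Set.disjoint_left]
    rintro _ ⟨p, rfl⟩ ⟨p', h⟩
    simp only [Prod.mk.injEq] at h
    lia
  · refine codisjoint_iff.mpr (Set.eq_univ_of_forall fun ⟨m, n⟩ ↦ ?_)
    rcases Int.even_or_odd' (m + n) with ⟨s, h | h⟩
    · exact Or.inl ⟨(s, s - n), by simp only [Prod.mk.injEq]; lia⟩
    · exact Or.inr ⟨(s + 1, s + 1 - n), by simp only [Prod.mk.injEq]; lia⟩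

/-- The product formula `f(a, b) f(c, d) = f(ac, bd) f(ad, bc) + a f(b/c, ac²d) f(b/d, acd²)`
for `a = q`, `b = q ^ 5`, `c = d = -q ^ 3`. -/
theorem quadTheta_mul_eq_sq_add_sq {q : ℂ} (hq0 : q ≠ 0) (hq : ‖q‖ < 1) :
    quadTheta 1 q 3 2 * quadTheta (-1) q 3 0 =
      quadTheta (-1) q 6 2 ^ 2 + q * quadTheta (-1) q 6 (-4) ^ 2 := by
  have h1 : (1 : ℂ) ≠ 0 := one_ne_zero
  have hn : (-1 : ℂ) ≠ 0 := by simp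
  have hs (s t : ℤ) : (-1 : ℂ) ^ (s - t) = (-1) ^ s * (-1) ^ t := by
    rw [zpow_sub₀ hn, div_eq_mul_inv, ← inv_zpow, inv_neg_one]
  rw [quadTheta_mul h1 hn hq0 hq (by lia) (by lia),
    tsum_eq_add_of_parity (summable_quadTheta_mul h1 hn hq0 hq (by lia) (by lia) _ _),
    sq, sq, quadTheta_mul hn hn hq0 hq (by lia) (by lia),
    quadTheta_mul hn hn hq0 hq (by lia) (by lia), ← tsum_mul_left]
  congr 1 <;> refine tsum_congr fun p ↦ ?_
  · rw [hs, one_zpow, one_mul]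
    congr 2
    ring
  · rw [hs, one_zpow, one_mul, mul_left_comm q, ← zpow_one_add₀ hq0]
    congr 2
    ring

theorem tsum_comp_involutive {e : ℤ × ℤ → ℤ × ℤ} (he : Function.Involutive e)
    {F G : ℤ × ℤ → ℂ} (h : ∀ p, F p = G (e p)) : ∑' p, F p = ∑' p, G p :=
  (tsum_congr h).trans (he.toPerm.tsum_eq G)

/-- A relation under `q ↦ q ^ 4` between the binary theta series attached to the two
cosets of the lattice of the form `m² + 3n²`. -/
theorem two_mul_quadTheta_mul {q : ℂ} (hq0 : q ≠ 0) (hq : ‖q‖ < 1) :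
    2 * (quadTheta 1 q 1 0 * quadTheta 1 q 3 2) =
      quadTheta 1 q 1 1 * quadTheta 1 q 3 1 +
        2 * q * (quadTheta 1 (q ^ 4) 1 0 * quadTheta 1 (q ^ 4) 3 2 +
          quadTheta 1 (q ^ 4) 1 1 * quadTheta 1 (q ^ 4) 3 1) := by
  have h1 : (1 : ℂ) ≠ 0 := one_ne_zero
  have hq4 := norm_pow_lt_one hq four_ne_zero
  have hq40 : q ^ 4 ≠ 0 := pow_ne_zero _ hq0
  have z (k : ℤ) : q * (q ^ 4) ^ k = q ^ (4 * k + 1) := by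
    rw [zpow_add_one₀ hq0, zpow_mul, mul_comm]
    rfl
  have hP := summable_quadTheta_mul h1 h1 hq0 hq one_pos three_pos 0 2
  have hR := summable_quadTheta_mul h1 h1 hq0 hq one_pos three_pos 1 1
  have mulP := quadTheta_mul h1 h1 hq0 hq one_pos three_pos 0 2
  have mulR := quadTheta_mul h1 h1 hq0 hq one_pos three_pos 1 1
  have mulP4 := quadTheta_mul h1 h1 hq40 hq4 one_pos three_pos 0 2
  have mulR4 := quadTheta_mul h1 h1 hq40 hq4 one_pos three_pos 1 1
  simp only [one_zpow, one_mul] at hP hR mulP mulR mulP4 mulR4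
  have hP' := hP.comp_injective injective_add_sub_one
  simp only [Function.comp_def] at hP'
  rw [tsum_eq_add_of_parity hP, tsum_eq_add_of_parity hP'] at mulP
  rw [tsum_eq_add_of_parity hR] at mulR
  have evenR := tsum_comp_involutive (e := fun p ↦ (p.1 - p.2, -p.2))
    (F := fun p : ℤ × ℤ ↦ q ^ ((p.1 + p.2) ^ 2 + 0 * (p.1 + p.2) +
      (3 * (p.1 - p.2) ^ 2 + 2 * (p.1 - p.2))))
    (G := fun p : ℤ × ℤ ↦ q ^ ((p.1 + p.2) ^ 2 + (p.1 + p.2) +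
      (3 * (p.1 - p.2) ^ 2 + (p.1 - p.2))))
    (fun p ↦ by ext <;> simp) (fun p ↦ by dsimp only; congr 1; ring)
  have oddR := tsum_comp_involutive (e := fun p ↦ (-p.1, p.2 - p.1))
    (F := fun p : ℤ × ℤ ↦ q ^ ((p.1 + p.2) ^ 2 + 0 * (p.1 + p.2) +
      (3 * (p.1 - p.2) ^ 2 + 2 * (p.1 - p.2))))
    (G := fun p : ℤ × ℤ ↦ q ^ ((p.1 + p.2 - 1) ^ 2 + (p.1 + p.2 - 1) +
      (3 * (p.1 - p.2) ^ 2 + (p.1 - p.2))))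
    (fun p ↦ by ext <;> simp) (fun p ↦ by dsimp only; congr 1; ring)
  have oddP : q * (quadTheta 1 (q ^ 4) 1 1 * quadTheta 1 (q ^ 4) 3 1) =
      ∑' p : ℤ × ℤ, q ^ ((p.1 + p.2 + (p.1 - p.2) - 1) ^ 2 +
        0 * (p.1 + p.2 + (p.1 - p.2) - 1) + (3 * (p.1 + p.2 - (p.1 - p.2)) ^ 2 +
        2 * (p.1 + p.2 - (p.1 - p.2)))) := by
    rw [mulR4, ← tsum_mul_left]
    refine tsum_comp_involutive (e := fun p ↦ (-p.1, p.2)) (fun p ↦ by ext <;> simp) fun p ↦ ?_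
    rw [z]
    congr 1
    ring
  have oddP' : q * (quadTheta 1 (q ^ 4) 1 0 * quadTheta 1 (q ^ 4) 3 2) =
      ∑' p : ℤ × ℤ, q ^ ((p.1 + p.2 - 1 + (p.1 - p.2) - 1) ^ 2 +
        0 * (p.1 + p.2 - 1 + (p.1 - p.2) - 1) + (3 * (p.1 + p.2 - 1 - (p.1 - p.2)) ^ 2 +
        2 * (p.1 + p.2 - 1 - (p.1 - p.2)))) := by
    rw [mulP4, ← tsum_mul_left]
    refine tsum_comp_involutive (e := fun p ↦ (1 - p.1, -p.2)) (fun p ↦ by ext <;> simp) fun p ↦ ?_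
    rw [z]
    congr 1
    ring
  rw [← oddP, ← oddP', evenR] at mulP
  rw [← oddR, evenR] at mulR
  rw [mulP, mulR]
  ring

/-! ### Product evaluations -/

theorem qPoch_self_sq {q : ℂ} (hq : ‖q‖ < 1) : qPoch q (q ^ 2) = eulerE q / eulerE (q ^ 2) := by
  rw [eq_div_iff (eulerE_ne_zero (norm_pow_lt_one hq two_ne_zero)), eulerE_eq_qPoch,
    eulerE_eq_qPoch, qPoch_eq_mul_two q hq, ← sq]

theorem qPoch_neg_self {q : ℂ} (hq : ‖q‖ < 1) : qPoch (-q) q = eulerE (q ^ 2) / eulerE q := by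
  rw [eq_div_iff (eulerE_ne_zero hq), eulerE_eq_qPoch, eulerE_eq_qPoch,
    ← qPoch_mul_qPoch_neg q hq, mul_comm]

theorem qPoch_neg_self_sq {q : ℂ} (hq : ‖q‖ < 1) :
    qPoch (-q) (q ^ 2) = eulerE (q ^ 2) ^ 2 / (eulerE q * eulerE (q ^ 4)) := by
  have hq2 := norm_pow_lt_one hq two_ne_zero
  have h1 := eulerE_ne_zero hq
  have h2 := eulerE_ne_zero hq2
  have h4 := eulerE_ne_zero (norm_pow_lt_one hq four_ne_zero)
  have h := qPoch_mul_qPoch_neg q hq2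
  rw [qPoch_self_sq hq, qPoch_self_sq hq2, ← pow_mul] at h
  norm_num at h
  field_simp at h ⊢
  linear_combination h

theorem quadTheta_one_one_zero {q : ℂ} (hq0 : q ≠ 0) (hq : ‖q‖ < 1) :
    quadTheta 1 q 1 0 = eulerE (q ^ 2) ^ 5 / (eulerE q ^ 2 * eulerE (q ^ 4) ^ 2) := by
  have h := quadTheta_eq one_ne_zero hq0 hq one_pos 0
  norm_num [zpow_ofNat] at h
  rw [h, qPoch_neg_self_sq hq]
  ring

theorem quadTheta_one_three_two {q : ℂ} (hq0 : q ≠ 0) (hq : ‖q‖ < 1) :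
    quadTheta 1 q 3 2 = eulerE (q ^ 2) ^ 2 * eulerE (q ^ 3) * eulerE (q ^ 12) /
      (eulerE q * eulerE (q ^ 4) * eulerE (q ^ 6)) := by
  have h := quadTheta_eq one_ne_zero hq0 hq three_pos 2
  norm_num [zpow_ofNat] at h
  have h3 := qPoch_eq_mul_three (-q) (norm_pow_lt_one hq two_ne_zero)
  have e := qPoch_neg_self_sq (norm_pow_lt_one hq three_ne_zero)
  simp only [← pow_mul, neg_mul, ← pow_succ'] at h3 e
  norm_num at h3 e
  have h1 := eulerE_ne_zero hq
  have n4 := eulerE_ne_zero (norm_pow_lt_one hq (show 4 ≠ 0 by lia))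
  have n3 := eulerE_ne_zero (norm_pow_lt_one hq (show 3 ≠ 0 by lia))
  have n6 := eulerE_ne_zero (norm_pow_lt_one hq (show 6 ≠ 0 by lia))
  have n12 := eulerE_ne_zero (norm_pow_lt_one hq (show 12 ≠ 0 by lia))
  rw [qPoch_neg_self_sq hq, e] at h3
  rw [h]
  field_simp at h3 ⊢
  linear_combination -h3

theorem quadTheta_neg_one_three_zero {q : ℂ} (hq0 : q ≠ 0) (hq : ‖q‖ < 1) :
    quadTheta (-1) q 3 0 = eulerE (q ^ 3) ^ 2 / eulerE (q ^ 6) := by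
  have h := quadTheta_eq (neg_ne_zero.mpr one_ne_zero) hq0 hq three_pos 0
  norm_num [zpow_ofNat] at h
  have e := qPoch_self_sq (norm_pow_lt_one hq three_ne_zero)
  rw [← pow_mul] at e
  norm_num at e
  have n6 := eulerE_ne_zero (norm_pow_lt_one hq (show 6 ≠ 0 by lia))
  rw [h, e]
  field_simp

theorem quadTheta_neg_one_six_two {q : ℂ} (hq0 : q ≠ 0) (hq : ‖q‖ < 1) :
    quadTheta (-1) q 6 2 = eulerE (q ^ 4) := by
  have h := quadTheta_eq (neg_ne_zero.mpr one_ne_zero) hq0 hq (show (0 : ℤ) < 6 by lia) 2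
  norm_num [zpow_ofNat] at h
  have e := qPoch_eq_mul_three (q ^ 4) (norm_pow_lt_one hq four_ne_zero)
  simp only [← pow_mul, ← pow_add] at e
  norm_num at e
  rw [h, eulerE_eq_qPoch, eulerE_eq_qPoch, e]
  ring

theorem quadTheta_neg_one_six_neg_four {q : ℂ} (hq0 : q ≠ 0) (hq : ‖q‖ < 1) :
    quadTheta (-1) q 6 (-4) =
      eulerE (q ^ 2) * eulerE (q ^ 12) ^ 2 / (eulerE (q ^ 4) * eulerE (q ^ 6)) := by
  have h := quadTheta_eq (neg_ne_zero.mpr one_ne_zero) hq0 hq (show (0 : ℤ) < 6 by lia) (-4)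
  norm_num [zpow_ofNat] at h
  have h3 := qPoch_eq_mul_three (q ^ 2) (norm_pow_lt_one hq four_ne_zero)
  have e2 := qPoch_self_sq (norm_pow_lt_one hq two_ne_zero)
  have e6 := qPoch_self_sq (norm_pow_lt_one hq (show 6 ≠ 0 by lia))
  simp only [← pow_mul, ← pow_add] at h3 e2 e6
  norm_num at h3 e2 e6
  have n4 := eulerE_ne_zero (norm_pow_lt_one hq (show 4 ≠ 0 by lia))
  have n6 := eulerE_ne_zero (norm_pow_lt_one hq (show 6 ≠ 0 by lia))
  have n12 := eulerE_ne_zero (norm_pow_lt_one hq (show 12 ≠ 0 by lia))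
  rw [e2, e6] at h3
  rw [h]
  field_simp at h3 ⊢
  linear_combination -h3

theorem quadTheta_one_one_one {q : ℂ} (hq0 : q ≠ 0) (hq : ‖q‖ < 1) :
    quadTheta 1 q 1 1 = 2 * eulerE (q ^ 4) ^ 2 / eulerE (q ^ 2) := by
  have hq2 := norm_pow_lt_one hq two_ne_zero
  have h := quadTheta_eq one_ne_zero hq0 hq one_pos 1
  norm_num [zpow_ofNat] at h
  have e1 := qPoch_eq_one_sub_mul (-1) hq2
  have e := qPoch_neg_self hq2
  rw [← pow_mul] at e
  norm_num at e e1
  have n2 := eulerE_ne_zero hq2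
  rw [h, e1, e]
  field_simp

theorem quadTheta_one_three_one {q : ℂ} (hq0 : q ≠ 0) (hq : ‖q‖ < 1) :
    quadTheta 1 q 3 1 =
      eulerE (q ^ 4) * eulerE (q ^ 6) ^ 2 / (eulerE (q ^ 2) * eulerE (q ^ 12)) := by
  have hq2 := norm_pow_lt_one hq two_ne_zero
  have h := quadTheta_eq one_ne_zero hq0 hq three_pos 1
  norm_num [zpow_ofNat] at h
  have h3 := qPoch_eq_mul_three (-q ^ 2) hq2
  have e2 := qPoch_neg_self hq2
  have e6 := qPoch_neg_self (norm_pow_lt_one hq (show 6 ≠ 0 by lia))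
  simp only [← pow_mul, neg_mul, ← pow_add] at h3 e2 e6
  norm_num at h3 e2 e6
  have n2 := eulerE_ne_zero hq2
  have n6 := eulerE_ne_zero (norm_pow_lt_one hq (show 6 ≠ 0 by lia))
  have n12 := eulerE_ne_zero (norm_pow_lt_one hq (show 12 ≠ 0 by lia))
  rw [e2, e6] at h3
  rw [h]
  field_simp at h3 ⊢
  linear_combination -h3

/-! ### The eta-quotient identity -/

/-- The `2`-dissection of `E(q³)³ / E(q)`. -/
theorem eulerE_cube_div_eq {q : ℂ} (hq0 : q ≠ 0) (hq : ‖q‖ < 1) :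
    eulerE (q ^ 3) ^ 3 / eulerE q =
      eulerE (q ^ 4) ^ 3 * eulerE (q ^ 6) ^ 2 / (eulerE (q ^ 2) ^ 2 * eulerE (q ^ 12)) +
        q * (eulerE (q ^ 12) ^ 3 / eulerE (q ^ 4)) := by
  have h := quadTheta_mul_eq_sq_add_sq hq0 hq
  rw [quadTheta_one_three_two hq0 hq, quadTheta_neg_one_three_zero hq0 hq,
    quadTheta_neg_one_six_two hq0 hq, quadTheta_neg_one_six_neg_four hq0 hq] at h
  have n1 := eulerE_ne_zero hq
  have n2 := eulerE_ne_zero (norm_pow_lt_one hq (show 2 ≠ 0 by lia))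
  have n4 := eulerE_ne_zero (norm_pow_lt_one hq (show 4 ≠ 0 by lia))
  have n6 := eulerE_ne_zero (norm_pow_lt_one hq (show 6 ≠ 0 by lia))
  have n12 := eulerE_ne_zero (norm_pow_lt_one hq (show 12 ≠ 0 by lia))
  field_simp at h ⊢
  linear_combination h

/-- The difference of the two sides of the eta-quotient identity. -/
noncomputable def etaDefect (q : ℂ) : ℂ :=
  eulerE (q ^ 2) ^ 7 * eulerE (q ^ 3) * eulerE (q ^ 12) /
      (eulerE q ^ 3 * eulerE (q ^ 4) ^ 3 * eulerE (q ^ 6))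
    + 2 * eulerE (q ^ 4) ^ 3 * eulerE (q ^ 6) ^ 2 / (eulerE (q ^ 2) ^ 2 * eulerE (q ^ 12))
    - 3 * eulerE (q ^ 3) ^ 3 / eulerE q

theorem etaDefect_zero : etaDefect 0 = 0 := by
  norm_num [etaDefect, eulerE_zero]

theorem continuousAt_etaDefect_zero : ContinuousAt etaDefect 0 := by
  have h (n : ℕ) (hn : n ≠ 0) : ContinuousAt (fun q : ℂ ↦ eulerE (q ^ n)) 0 := by
    refine ContinuousAt.comp (g := eulerE) (f := fun q : ℂ ↦ q ^ n) ?_ (by fun_prop)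
    rw [zero_pow hn]
    exact continuousAt_eulerE_zero
  have h1 := continuousAt_eulerE_zero
  have h2 := h 2 (by lia)
  have h3 := h 3 (by lia)
  have h4 := h 4 (by lia)
  have h6 := h 6 (by lia)
  have h12 := h 12 (by lia)
  unfold etaDefect
  fun_prop (disch := simp [eulerE_zero])

theorem etaDefect_eq_quadTheta {q : ℂ} (hq0 : q ≠ 0) (hq : ‖q‖ < 1) :
    etaDefect q = quadTheta 1 q 1 0 * quadTheta 1 q 3 2 + quadTheta 1 q 1 1 * quadTheta 1 q 3 1
      - 3 * (eulerE (q ^ 3) ^ 3 / eulerE q) := by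
  have n1 := eulerE_ne_zero hq
  have n2 := eulerE_ne_zero (norm_pow_lt_one hq (show 2 ≠ 0 by lia))
  rw [quadTheta_one_one_zero hq0 hq, quadTheta_one_three_two hq0 hq,
    quadTheta_one_one_one hq0 hq, quadTheta_one_three_one hq0 hq, etaDefect]
  congr 1
  · congr 1 <;> field_simp
  · ring

theorem etaDefect_eq_mul {q : ℂ} (hq : ‖q‖ < 1) : etaDefect q = q * etaDefect (q ^ 4) := by
  rcases eq_or_ne q 0 with rfl | hq0
  · simp [etaDefect_zero]
  rw [etaDefect_eq_quadTheta hq0 hq,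
    etaDefect_eq_quadTheta (pow_ne_zero 4 hq0) (norm_pow_lt_one hq four_ne_zero), ← pow_mul]
  have h := two_mul_quadTheta_mul hq0 hq
  have hR : quadTheta 1 q 1 1 * quadTheta 1 q 3 1 = 2 * (eulerE (q ^ 4) ^ 3 *
      eulerE (q ^ 6) ^ 2 / (eulerE (q ^ 2) ^ 2 * eulerE (q ^ 12))) := by
    rw [quadTheta_one_one_one hq0 hq, quadTheta_one_three_one hq0 hq]
    ring
  linear_combination h / 2 + 3 / 2 * hR - 3 * eulerE_cube_div_eq hq0 hq

theorem norm_etaDefect_le {q : ℂ} (hq : ‖q‖ < 1) (k : ℕ) :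
    ‖etaDefect q‖ ≤ ‖etaDefect (q ^ 4 ^ k)‖ := by
  induction k with
  | zero => simp
  | succ k ih =>
    have hk := norm_pow_lt_one hq (pow_ne_zero k four_ne_zero)
    refine ih.trans ?_
    rw [etaDefect_eq_mul hk, norm_mul, ← pow_mul, ← pow_succ]
    exact mul_le_of_le_one_left (norm_nonneg _) hk.le

theorem etaDefect_eq_zero {q : ℂ} (hq : ‖q‖ < 1) : etaDefect q = 0 := by
  have h1 : Tendsto (fun k : ℕ ↦ q ^ 4 ^ k) atTop (𝓝 0) :=
    (tendsto_pow_atTop_nhds_zero_of_norm_lt_one hq).comp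
      (tendsto_pow_atTop_atTop_of_one_lt (by lia))
  have h2 := (continuousAt_etaDefect_zero.tendsto.comp h1).norm
  rw [etaDefect_zero, norm_zero] at h2
  exact norm_le_zero_iff.mp (ge_of_tendsto' h2 (norm_etaDefect_le hq))

/-- Eta-quotient identity:
$\frac{E(q^2)^7E(q^3)E(q^{12})}{E(q)^3E(q^4)^3E(q^6)}
 + \frac{2E(q^4)^3E(q^6)^2}{E(q^2)^2E(q^{12})} = \frac{3E(q^3)^3}{E(q)}$. -/
theorem eta_quotient_13_1 (q : ℂ) (hq : ‖q‖ < 1) :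
    eulerE (q ^ 2) ^ 7 * eulerE (q ^ 3) * eulerE (q ^ 12) /
        (eulerE q ^ 3 * eulerE (q ^ 4) ^ 3 * eulerE (q ^ 6))
      + 2 * eulerE (q ^ 4) ^ 3 * eulerE (q ^ 6) ^ 2 /
          (eulerE (q ^ 2) ^ 2 * eulerE (q ^ 12))
      = 3 * eulerE (q ^ 3) ^ 3 / eulerE q :=
  sub_eq_zero.mp (etaDefect_eq_zero hq)
end
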